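/- arXiv:2111.05813 — 12 statements merged into one kernel-verified Lean document; each statement's English description precedes it below -/
import Mathlib

section
/- Let p be an odd prime, l ≥ 1 an integer, and ξ ∈ ℤ/p^lℤ an element whose image in ℤ/pℤ is not a square (a quadratic nonresidue modulo p). Let g ∈ GL₂(ℤ/p^lℤ) be such that g is not a scalar matrix but g² is a scalar matrix (i.e., the image of g in PGL₂(ℤ/p^lℤ) has order 2). Then there exist γ ∈ GL₂(ℤ/p^lℤ) and a unit β ∈ (ℤ/p^lℤ)ˣ such that γ⁻¹gγ = β·[[1,0],[0,-1]] if the image of -det(g) in ℤ/pℤ is a square, and γ⁻¹gγ = β·[[0,ξ],[1,0]] if the image of -det(g) in ℤ/pℤ is not a square. In particular there are exactly two conjugacy classes of elements of order 2 in PGL₂(ℤ/p^lℤ). -/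
open Matrix

/-- The reduction `ℤ/nℤ → ℤ/mℤ` has kernel generated by `m`. -/
theorem ZMod.natCast_dvd_of_castHom_eq_zero {m n : ℕ} [NeZero n] (h : m ∣ n) {x : ZMod n}
    (hx : ZMod.castHom h (ZMod m) x = 0) : (m : ZMod n) ∣ x := by
  rw [← ZMod.natCast_zmod_val x, map_natCast, ZMod.natCast_eq_zero_iff] at hx
  rw [← ZMod.natCast_zmod_val x]
  exact Nat.cast_dvd_cast hx

theorem IsUnit.isSquare_of_odd_pow {M : Type*} [CommMonoid M] {x : M} {n : ℕ} (hx : IsUnit x)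
    (hn : Odd n) (hsq : IsSquare (x ^ n)) : IsSquare x := by
  obtain ⟨k, rfl⟩ := hn
  obtain ⟨u, rfl⟩ := hx
  obtain ⟨y, hy⟩ := hsq
  refine ⟨↑(u⁻¹ ^ k) * y, ?_⟩
  rw [mul_mul_mul_comm, ← hy, ← Units.val_pow_eq_pow_val, ← Units.val_mul, ← Units.val_mul,
    Units.val_inj, pow_succ, ← mul_assoc, two_mul, pow_add, inv_pow, ← mul_inv, inv_mul_cancel,
    one_mul]

section PrimePower

variable {p : ℕ} [Fact p.Prime] {l : ℕ}

theorem ZMod.isUnit_of_castHom_ne_zero (h : p ∣ p ^ l) {x : ZMod (p ^ l)}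
    (hx : ZMod.castHom h (ZMod p) x ≠ 0) : IsUnit x := by
  obtain ⟨y, hy⟩ := ZMod.castHom_surjective h (ZMod.castHom h (ZMod p) x)⁻¹
  have hdvd : (p : ZMod (p ^ l)) ∣ x * y - 1 := by
    apply ZMod.natCast_dvd_of_castHom_eq_zero h
    rw [map_sub, map_mul, hy, map_one, mul_inv_cancel₀ hx, sub_self]
  have hnil : IsNilpotent (x * y - 1) := by
    obtain ⟨z, hz⟩ := hdvd
    refine ⟨l, ?_⟩
    rw [hz, mul_pow, ← Nat.cast_pow, ZMod.natCast_self, zero_mul]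
  have hunit := hnil.isUnit_add_one
  rw [sub_add_cancel] at hunit
  exact isUnit_of_mul_isUnit_left hunit

/-- For odd `p`, a unit of `ℤ/p^lℤ` that is a square modulo `p` is a square. -/
theorem ZMod.isSquare_of_isSquare_castHom (hodd : p ≠ 2) (h : p ∣ p ^ l) {x : ZMod (p ^ l)}
    (hx : ZMod.castHom h (ZMod p) x ≠ 0) (hsq : IsSquare (ZMod.castHom h (ZMod p) x)) :
    IsSquare x := by
  obtain ⟨s, hs⟩ := hsq
  obtain ⟨y, rfl⟩ := ZMod.castHom_surjective h s
  have hdvd : (p : ZMod (p ^ l)) ∣ x - y * y := by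
    apply ZMod.natCast_dvd_of_castHom_eq_zero h
    rw [map_sub, map_mul, hs, sub_self]
  have hpow : x ^ p ^ l = (y * y) ^ p ^ l := by
    have hzero := dvd_sub_pow_of_dvd_sub hdvd l
    rw [pow_succ, ← Nat.cast_pow, ZMod.natCast_self, zero_mul, zero_dvd_iff] at hzero
    exact sub_eq_zero.mp hzero
  refine (ZMod.isUnit_of_castHom_ne_zero h hx).isSquare_of_odd_pow (n := p ^ l)
    ((Fact.out : p.Prime).odd_of_ne_two hodd).pow ?_
  rw [hpow]
  exact (IsSquare.mul_self y).pow _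

end PrimePower

section Local

variable {R F : Type*} [CommRing R] [Field F] (φ : R →+* F)

/-- Over a local ring in which `2` is invertible, a non-scalar invertible `2 × 2` matrix with
scalar square has trace zero. -/
theorem Matrix.trace_eq_zero_of_sq_scalar (hφ : ∀ x, φ x ≠ 0 → IsUnit x) (h2 : (2 : F) ≠ 0)
    {M : Matrix (Fin 2) (Fin 2) R} (hdet : φ M.det ≠ 0)
    (hns : ¬ ∃ c : R, M = c • (1 : Matrix (Fin 2) (Fin 2) R))
    (hsq : ∃ c : R, M ^ 2 = c • (1 : Matrix (Fin 2) (Fin 2) R)) : M.trace = 0 := by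
  obtain ⟨c, hc⟩ := hsq
  have h00 := congrFun₂ hc 0 0
  have h01 := congrFun₂ hc 0 1
  have h10 := congrFun₂ hc 1 0
  have h11 := congrFun₂ hc 1 1
  simp [pow_two, Matrix.mul_apply, Fin.sum_univ_two] at h00 h01 h10 h11
  have hb : M.trace * M 0 1 = 0 := by rw [trace_fin_two]; linear_combination h01
  have hc' : M.trace * M 1 0 = 0 := by rw [trace_fin_two]; linear_combination h10
  have had : M.trace * (M 0 0 - M 1 1) = 0 := by
    rw [trace_fin_two]; linear_combination h00 - h11
  by_contra ht
  have hzero : ∀ x, M.trace * x = 0 → φ x = 0 := fun x hx ↦ by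
    by_contra hne
    exact ht ((hφ x hne).mul_left_eq_zero.mp hx)
  by_cases hφt : φ M.trace = 0
  · have hφad := hzero _ had
    rw [map_sub] at hφad
    rw [trace_fin_two, map_add] at hφt
    have ha : φ (M 0 0) = 0 := by
      refine (mul_eq_zero.mp (?_ : (2 : F) * φ (M 0 0) = 0)).resolve_left h2
      linear_combination hφt + hφad
    apply hdet
    rw [det_fin_two, map_sub, map_mul, map_mul, ha, hzero _ hb]
    ring
  · have hu := hφ _ hφt
    rw [hu.mul_right_eq_zero] at hb hc' had
    refine hns ⟨M 0 0, ?_⟩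
    ext i j
    fin_cases i <;> fin_cases j <;> simp [hb, hc', sub_eq_zero.mp had]

/-- Over a local ring in which `2` is invertible, an invertible trace-zero `2 × 2` matrix is
conjugate to its companion matrix. -/
theorem Matrix.exists_conj_companion_of_trace_eq_zero (hφ : ∀ x, φ x ≠ 0 → IsUnit x)
    (h2 : (2 : F) ≠ 0) {M : Matrix (Fin 2) (Fin 2) R} (hdet : φ M.det ≠ 0)
    (htr : M.trace = 0) :
    ∃ P : Matrix (Fin 2) (Fin 2) R, IsUnit P.det ∧ M * P = P * !![0, -M.det; 1, 0] := by
  have hd : M 1 1 = -M 0 0 := by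
    rw [trace_fin_two] at htr
    linear_combination htr
  have key : ∀ x y : R,
      φ (x * (M 1 0 * x + M 1 1 * y) - (M 0 0 * x + M 0 1 * y) * y) ≠ 0 →
      ∃ P : Matrix (Fin 2) (Fin 2) R, IsUnit P.det ∧ M * P = P * !![0, -M.det; 1, 0] := by
    intro x y hxy
    refine ⟨!![x, M 0 0 * x + M 0 1 * y; y, M 1 0 * x + M 1 1 * y], ?_, ?_⟩
    · rw [det_fin_two_of]
      exact hφ _ hxy
    · ext i j
      fin_cases i <;> fin_cases j <;>
        simp [Matrix.mul_apply, Fin.sum_univ_two, det_fin_two, hd] <;> ring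
  by_cases hc : φ (M 1 0) = 0
  · by_cases hb : φ (M 0 1) = 0
    · apply key 1 1
      intro h
      apply hdet
      have ha : φ (M 0 0) = 0 := by
        refine (mul_eq_zero.mp (?_ : (2 : F) * φ (M 0 0) = 0)).resolve_left h2
        simp [hd, hb, hc] at h
        linear_combination -h
      simp [det_fin_two, ha, hb]
    · exact key 0 1 (by simpa using hb)
  · exact key 1 0 (by simpa using hc)

end Local

theorem Matrix.GeneralLinearGroup.exists_inv_mul_mul_eq {n R : Type*} [Fintype n] [DecidableEq n]
    [CommRing R] {M N P : Matrix n n R} (hP : IsUnit P.det) (h : M * P = P * N) :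
    ∃ γ : GL n R, ((γ⁻¹ : GL n R) : Matrix n n R) * M * (γ : Matrix n n R) = N := by
  obtain ⟨γ, rfl⟩ := (isUnit_iff_isUnit_det P).mpr hP
  refine ⟨γ, ?_⟩
  rw [mul_assoc, h, ← mul_assoc, Units.inv_mul, one_mul]


/-- Lemma 3.3: there are exactly two conjugacy classes of elements of order 2 in
`PGL₂(ℤ/p^lℤ)`.  An element `g` of `GL₂(ℤ/p^lℤ)` which is non-scalar but whose square is
scalar is conjugate, up to a unit scalar `β`, to `[[1,0],[0,-1]]` if `-det g` is a square
modulo `p`, and to `[[0,ξ],[1,0]]` otherwise, where `ξ` is a quadratic nonresidue mod `p`. -/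
theorem order_two_conjugacy_classes_PGL2
    (p : ℕ) (hp : p.Prime) (hodd : p ≠ 2) (l : ℕ) (hl : 1 ≤ l)
    (ξ : ZMod (p ^ l))
    (hξ : ¬ IsSquare (ZMod.castHom (dvd_pow_self p (Nat.one_le_iff_ne_zero.mp hl))
      (ZMod p) ξ))
    (g : GL (Fin 2) (ZMod (p ^ l)))
    (hg_nonscalar : ¬ ∃ c : ZMod (p ^ l),
      (g : Matrix (Fin 2) (Fin 2) (ZMod (p ^ l))) = c • (1 : Matrix (Fin 2) (Fin 2) (ZMod (p ^ l))))
    (hg_sq_scalar : ∃ c : ZMod (p ^ l),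
      (g : Matrix (Fin 2) (Fin 2) (ZMod (p ^ l))) ^ 2
        = c • (1 : Matrix (Fin 2) (Fin 2) (ZMod (p ^ l)))) :
    ∃ (γ : GL (Fin 2) (ZMod (p ^ l))) (β : (ZMod (p ^ l))ˣ),
      (IsSquare (ZMod.castHom (dvd_pow_self p (Nat.one_le_iff_ne_zero.mp hl)) (ZMod p)
          (-(Matrix.det (g : Matrix (Fin 2) (Fin 2) (ZMod (p ^ l)))))) →
        ((γ⁻¹ : GL (Fin 2) (ZMod (p ^ l))) : Matrix (Fin 2) (Fin 2) (ZMod (p ^ l))) *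
            (g : Matrix (Fin 2) (Fin 2) (ZMod (p ^ l))) * (γ : Matrix (Fin 2) (Fin 2) (ZMod (p ^ l)))
          = (β : ZMod (p ^ l)) • !![1, 0; 0, -1]) ∧
      (¬ IsSquare (ZMod.castHom (dvd_pow_self p (Nat.one_le_iff_ne_zero.mp hl)) (ZMod p)
          (-(Matrix.det (g : Matrix (Fin 2) (Fin 2) (ZMod (p ^ l)))))) →
        ((γ⁻¹ : GL (Fin 2) (ZMod (p ^ l))) : Matrix (Fin 2) (Fin 2) (ZMod (p ^ l))) *
            (g : Matrix (Fin 2) (Fin 2) (ZMod (p ^ l))) * (γ : Matrix (Fin 2) (Fin 2) (ZMod (p ^ l)))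
          = (β : ZMod (p ^ l)) • !![0, ξ; 1, 0]) := by
  have : Fact p.Prime := ⟨hp⟩
  have hdvd : p ∣ p ^ l := dvd_pow_self p (Nat.one_le_iff_ne_zero.mp hl)
  set φ := ZMod.castHom hdvd (ZMod p)
  set M : Matrix (Fin 2) (Fin 2) (ZMod (p ^ l)) := Units.val g
  have hφ : ∀ x, φ x ≠ 0 → IsUnit x := fun x ↦ ZMod.isUnit_of_castHom_ne_zero hdvd
  have h2 : (2 : ZMod p) ≠ 0 := Ring.two_ne_zero (by rwa [ZMod.ringChar_zmod_n])
  have hdet : φ M.det ≠ 0 := (((isUnit_iff_isUnit_det M).mp g.isUnit).map φ).ne_zero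
  obtain ⟨P, hP, hMP⟩ := exists_conj_companion_of_trace_eq_zero φ hφ h2 hdet
    (trace_eq_zero_of_sq_scalar φ hφ h2 hdet hg_nonscalar hg_sq_scalar)
  have hD : φ (-M.det) ≠ 0 := by rwa [map_neg, neg_ne_zero]
  by_cases hsq : IsSquare (φ (-M.det))
  · obtain ⟨b, hb⟩ := ZMod.isSquare_of_isSquare_castHom hodd hdvd hD hsq
    have hbu : IsUnit b := isUnit_of_mul_isUnit_left (hb ▸ hφ _ hD)
    obtain ⟨β, rfl⟩ := hbu
    have h2u : IsUnit (2 : ZMod (p ^ l)) := hφ 2 (by rwa [map_ofNat])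
    obtain ⟨γ, hγ⟩ := GeneralLinearGroup.exists_inv_mul_mul_eq
      (M := M) (N := (β : ZMod (p ^ l)) • !![1, 0; 0, -1]) (P := P * !![(β : ZMod (p ^ l)), -β; 1, 1])
      (by
        rw [det_mul, det_fin_two_of]
        refine hP.mul ?_
        convert h2u.mul β.isUnit using 1
        ring)
      (by
        rw [← mul_assoc, hMP, hb, mul_assoc P, mul_assoc P]
        congr 1
        ext i j
        fin_cases i <;> fin_cases j <;> simp)
    exact ⟨γ, β, fun _ ↦ hγ, fun h ↦ absurd hsq h⟩
  · have hξ0 : φ ξ ≠ 0 := fun h ↦ hξ (by rw [h]; exact IsSquare.zero)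
    obtain ⟨ξu, hξu⟩ := hφ ξ hξ0
    have hinv : φ (↑ξu⁻¹) = (φ ξ)⁻¹ := by
      rw [← hξu]
      exact eq_inv_of_mul_eq_one_left (by rw [← map_mul, Units.inv_mul, map_one])
    have hquot0 : φ (-M.det * ↑ξu⁻¹) ≠ 0 := by
      rw [map_mul, hinv]
      exact mul_ne_zero hD (inv_ne_zero hξ0)
    have hquotsq : IsSquare (φ (-M.det * ↑ξu⁻¹)) := by
      rw [← quadraticChar_one_iff_isSquare hquot0, map_mul φ, map_mul,
        quadraticChar_neg_one_iff_not_isSquare.mpr hsq,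
        quadraticChar_neg_one_iff_not_isSquare.mpr (by rwa [hinv, isSquare_inv])]
      norm_num
    obtain ⟨b, hb⟩ := ZMod.isSquare_of_isSquare_castHom hodd hdvd hquot0 hquotsq
    have hbu : IsUnit b := isUnit_of_mul_isUnit_left (hb ▸ hφ _ hquot0)
    obtain ⟨β, rfl⟩ := hbu
    have hDβ : -M.det = β * β * ξ := by rw [← hb, ← hξu, Units.inv_mul_cancel_right]
    obtain ⟨γ, hγ⟩ := GeneralLinearGroup.exists_inv_mul_mul_eq
      (M := M) (N := (β : ZMod (p ^ l)) • !![0, ξ; 1, 0]) (P := P * !![(β : ZMod (p ^ l)), 0; 0, 1])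
      (by
        rw [det_mul, det_fin_two_of]
        refine hP.mul ?_
        simp)
      (by
        rw [← mul_assoc, hMP, hDβ, mul_assoc P, mul_assoc P]
        congr 1
        ext i j
        fin_cases i <;> fin_cases j <;> simp [mul_assoc])
    exact ⟨γ, β, fun h ↦ absurd h hsq, fun _ ↦ hγ⟩
end

section
/- Let k ≥ 1 be an integer and let g = [[1,-2],[2,-1]] as a matrix over ℤ/2^(k+1)ℤ. Then: (i) det(g) = 3; (ii) for every 2×2 matrix h over ℤ/2^(k+1)ℤ whose reduction modulo 2^k has the form [[a,-b],[b,a-b]] for some a, b ∈ ℤ/2^kℤ, one has g·h = h·g; (iii) g·[[1,-1],[0,-1]] = -([[1,-1],[0,-1]]·g). -/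
theorem ZMod.two_mul_eq_zero_of_castHom_eq_zero (k : ℕ) {x : ZMod (2 ^ (k + 1))}
    (hx : ZMod.castHom (pow_dvd_pow 2 k.le_succ) (ZMod (2 ^ k)) x = 0) : 2 * x = 0 := by
  obtain ⟨n, rfl⟩ := ZMod.natCast_zmod_surjective x
  rw [map_natCast, ZMod.natCast_eq_zero_iff] at hx
  obtain ⟨m, rfl⟩ := hx
  have h := ZMod.natCast_self (2 ^ (k + 1))
  push_cast at h ⊢
  linear_combination (m : ZMod (2 ^ (k + 1))) * h


/-- The key matrix computation in the nonsplit case of Proposition 3.5: over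
`ℤ/2^(k+1)ℤ` the matrix `g = [[1,-2],[2,-1]]` has determinant 3, commutes with every
matrix whose reduction mod `2^k` lies in the nonsplit Cartan shape `[[a,-b],[b,a-b]]`,
and anticommutes with `[[1,-1],[0,-1]]`. -/
theorem nonsplit_2adic_matrix_computation (k : ℕ) (hk : 1 ≤ k) :
    ((!![1, -2; 2, -1] : Matrix (Fin 2) (Fin 2) (ZMod (2 ^ (k + 1)))).det = 3) ∧
    (∀ h : Matrix (Fin 2) (Fin 2) (ZMod (2 ^ (k + 1))),
      (∃ a b : ZMod (2 ^ k),
        h.map ⇑(ZMod.castHom (pow_dvd_pow 2 k.le_succ) (ZMod (2 ^ k)))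
          = !![a, -b; b, a - b]) →
      (!![1, -2; 2, -1] : Matrix (Fin 2) (Fin 2) (ZMod (2 ^ (k + 1)))) * h
        = h * !![1, -2; 2, -1]) ∧
    ((!![1, -2; 2, -1] : Matrix (Fin 2) (Fin 2) (ZMod (2 ^ (k + 1)))) * !![1, -1; 0, -1]
      = -(!![1, -1; 0, -1] * (!![1, -2; 2, -1] : Matrix (Fin 2) (Fin 2) (ZMod (2 ^ (k + 1)))))) := by
  refine ⟨by rw [Matrix.det_fin_two_of]; ring, ?_, ?_⟩
  · rintro h ⟨a, b, hab⟩
    have h00 := congrFun₂ hab 0 0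
    have h01 := congrFun₂ hab 0 1
    have h10 := congrFun₂ hab 1 0
    have h11 := congrFun₂ hab 1 1
    simp only [Matrix.map_apply, Matrix.of_apply, Matrix.cons_val] at h00 h01 h10 h11
    have hanti : 2 * (h 0 1 + h 1 0) = 0 :=
      ZMod.two_mul_eq_zero_of_castHom_eq_zero k (by rw [map_add, h01, h10]; ring)
    have hdiag : 2 * (h 0 0 - h 1 0 - h 1 1) = 0 :=
      ZMod.two_mul_eq_zero_of_castHom_eq_zero k (by rw [map_sub, map_sub, h00, h10, h11]; ring)
    ext i j
    fin_cases i <;> fin_cases j <;> simp [Matrix.mul_apply, Fin.sum_univ_two]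
    · linear_combination -hanti
    · linear_combination hanti + hdiag
    · linear_combination hdiag
    · linear_combination hanti
  · ext i j
    fin_cases i <;> fin_cases j <;> simp [Matrix.mul_apply, Fin.sum_univ_two] <;> ring
end

section
/- Let x, y ∈ ℚ with x ≠ 1, x ≠ -2, and y² + y = x⁶ + 3x⁵ - 5x³ + 3x. Define u = (x⁴ + 2x³ - x + 3y + 4)/((x-1)²(x+2)²), v = (x⁶ + 3x⁵ + 6x⁴ + 7x³ + 3x²y - 6x² + 3xy - 9x + 3y + 16)/((x-1)³(x+2)³), and w = 3(2x+1)(x⁶ + 3x⁵ + 21x⁴ + 37x³ + 6x²y - 27x² + 6xy - 45x + 15y + 64)/((x-1)⁴(x+2)⁴). Then v² + v = u³ + 1 and w² = 3(3u² - 2u - 4v + 3)(9u² - 10u + 5). -/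
/-- Lemma 6.3(iii): the explicit birational map from the genus-2 model
`y² + y = x⁶ + 3x⁵ - 5x³ + 3x` of `X(ns 3, ns 5)/δ` to its affine model in `𝔸³`. -/
theorem genus2_to_affine_model_ns3ns5
    (x y u v w : ℚ) (hx1 : x ≠ 1) (hx2 : x ≠ -2)
    (hxy : y ^ 2 + y = x ^ 6 + 3 * x ^ 5 - 5 * x ^ 3 + 3 * x)
    (hu : u = (x ^ 4 + 2 * x ^ 3 - x + 3 * y + 4) / ((x - 1) ^ 2 * (x + 2) ^ 2))
    (hv : v = (x ^ 6 + 3 * x ^ 5 + 6 * x ^ 4 + 7 * x ^ 3 + 3 * x ^ 2 * y - 6 * x ^ 2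
        + 3 * x * y - 9 * x + 3 * y + 16) / ((x - 1) ^ 3 * (x + 2) ^ 3))
    (hw : w = 3 * (2 * x + 1) * (x ^ 6 + 3 * x ^ 5 + 21 * x ^ 4 + 37 * x ^ 3
        + 6 * x ^ 2 * y - 27 * x ^ 2 + 6 * x * y - 45 * x + 15 * y + 64)
        / ((x - 1) ^ 4 * (x + 2) ^ 4)) :
    v ^ 2 + v = u ^ 3 + 1 ∧
    w ^ 2 = 3 * (3 * u ^ 2 - 2 * u - 4 * v + 3) * (9 * u ^ 2 - 10 * u + 5) := by
  have h1 : x - 1 ≠ 0 := sub_ne_zero.mpr hx1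
  have h2 : x + 2 ≠ 0 := fun h => hx2 (eq_neg_of_add_eq_zero_left h)
  obtain ⟨t, ht⟩ : ∃ t, t = x ^ 2 + x := ⟨_, rfl⟩
  have hd : t - 2 ≠ 0 := by
    have h := mul_ne_zero h1 h2
    rwa [show (x - 1) * (x + 2) = t - 2 by rw [ht]; ring] at h
  have hF : y ^ 2 + y = t ^ 3 - 3 * t ^ 2 + 3 * t := by rw [hxy, ht]; ring
  have hu' : u = (t ^ 2 - t + 3 * y + 4) / (t - 2) ^ 2 := by
    rw [hu, ht]; congr 1 <;> ring
  have hv' : v = (t ^ 3 + 3 * t ^ 2 - 9 * t + 3 * y * (t + 1) + 16) / (t - 2) ^ 3 := by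
    rw [hv, ht]; congr 1 <;> ring
  have hw' : w ^ 2 = 9 * (4 * t + 1)
      * (t ^ 3 + 18 * t ^ 2 - 45 * t + 6 * t * y + 15 * y + 64) ^ 2 / (t - 2) ^ 8 := by
    rw [hw, div_pow, ht]; congr 1 <;> ring
  rw [hw', hu', hv']
  constructor
  · field_simp
    linear_combination (-72 - 27 * y + 45 * t - 18 * t ^ 2) * hF
  · field_simp
    linear_combination (-51840 - 18711 * y - 6561 * y ^ 2 + 35397 * t - 9720 * t * y
      - 19683 * t ^ 2 - 1944 * t ^ 2 * y - 81 * t ^ 3 - 324 * t ^ 4) * hF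
end

section
/- Let X, Y, Z ∈ ℚ with Z ≠ 0 satisfy the quartic 2X³Y - 2X³Z + X²Y² - 2X²YZ - 2X²Z² - 2XY³ + 2XY²Z + 2XYZ² - 2XZ³ - Y⁴ + 2Y³Z + Y²Z² - 2YZ³ = 0. Define u = 2(XY + Y² - XZ - YZ - Z²)/Z², v = 2(2X²Y + 2XY² - 2X²Z - 3XYZ - Y²Z - 2XZ² + YZ²)/Z³, and w = 2(X + 2Y - Z)(2XY + 2Y² - 2XZ - 2YZ - 3Z²)/Z³. Then v² = u³ + 8 and w² = 3(3u³ + 3u² + 2uv - 8u + 8). -/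
/-- Lemma 6.8(iii): the explicit birational map from the canonical plane quartic model
of `X(ns 8, ns 3)/δ` to its affine model in `𝔸³`. -/
theorem quartic_to_affine_model_ns8ns3
    (X Y Z u v w : ℚ) (hZ : Z ≠ 0)
    (hquartic : 2 * X ^ 3 * Y - 2 * X ^ 3 * Z + X ^ 2 * Y ^ 2 - 2 * X ^ 2 * Y * Z
      - 2 * X ^ 2 * Z ^ 2 - 2 * X * Y ^ 3 + 2 * X * Y ^ 2 * Z + 2 * X * Y * Z ^ 2
      - 2 * X * Z ^ 3 - Y ^ 4 + 2 * Y ^ 3 * Z + Y ^ 2 * Z ^ 2 - 2 * Y * Z ^ 3 = 0)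
    (hu : u = 2 * (X * Y + Y ^ 2 - X * Z - Y * Z - Z ^ 2) / Z ^ 2)
    (hv : v = 2 * (2 * X ^ 2 * Y + 2 * X * Y ^ 2 - 2 * X ^ 2 * Z - 3 * X * Y * Z
        - Y ^ 2 * Z - 2 * X * Z ^ 2 + Y * Z ^ 2) / Z ^ 3)
    (hw : w = 2 * (X + 2 * Y - Z) * (2 * X * Y + 2 * Y ^ 2 - 2 * X * Z - 2 * Y * Z
        - 3 * Z ^ 2) / Z ^ 3) :
    v ^ 2 = u ^ 3 + 8 ∧
    w ^ 2 = 3 * (3 * u ^ 3 + 3 * u ^ 2 + 2 * u * v - 8 * u + 8) := by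
  subst hu hv hw
  constructor <;> field_simp <;>
    linear_combination 4 * (2 * X * Y - 2 * X * Z + 2 * Y ^ 2 - 2 * Y * Z - 3 * Z ^ 2) * hquartic
end

section
/- Let u, v ∈ ℚ with v² + v = u³ + 1, u ≠ 0, and v ≠ -1. Set t = -(v+2)/(v+1) and s = -5u(v+3)(8v² + 23v + 17)/(v² + v - 1)². Then t² + t - 1 ≠ 0 and s³ = 5³(t+1)(2t+1)³(2t² - 3t + 3)³/(t² + t - 1)⁵. -/
/-- Lemma 6.3(i): compatibility of the forgetful maps from `X(ns 3⁺, ns 5⁺)` (modelled by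
`v² + v = u³ + 1`) to `X(ns 5⁺)` and `X(ns 3⁺)`: the cube of `s` equals the `j`-invariant
evaluated at `t`. -/
theorem forgetful_maps_ns3ns5
    (u v : ℚ) (huv : v ^ 2 + v = u ^ 3 + 1) (hu : u ≠ 0) (hv : v ≠ -1)
    (t s : ℚ)
    (ht : t = -(v + 2) / (v + 1))
    (hs : s = -5 * u * (v + 3) * (8 * v ^ 2 + 23 * v + 17) / (v ^ 2 + v - 1) ^ 2) :
    t ^ 2 + t - 1 ≠ 0 ∧
    s ^ 3 = 5 ^ 3 * (t + 1) * (2 * t + 1) ^ 3 * (2 * t ^ 2 - 3 * t + 3) ^ 3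
      / (t ^ 2 + t - 1) ^ 5 := by
  have hv' : v + 1 ≠ 0 := fun h => hv (by linarith)
  have hw : v ^ 2 + v - 1 = u ^ 3 := by linarith
  have h₁ : t + 1 = -1 / (v + 1) := by rw [ht]; field_simp; ring
  have h₂ : 2 * t + 1 = -(v + 3) / (v + 1) := by rw [ht]; field_simp; ring
  have h₃ : 2 * t ^ 2 - 3 * t + 3 = (8 * v ^ 2 + 23 * v + 17) / (v + 1) ^ 2 := by
    rw [ht]; field_simp; ring
  have h₄ : t ^ 2 + t - 1 = -u ^ 3 / (v + 1) ^ 2 := by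
    rw [← hw, ht]; field_simp; ring
  rw [hs, h₁, h₂, h₃, h₄, hw]
  generalize 8 * v ^ 2 + 23 * v + 17 = q
  generalize v + 3 = r
  refine ⟨by simp [hu, hv'], ?_⟩
  field_simp
end

section
/- Let u, v ∈ ℚ with v² + v = u³ + 1 and u ≠ 0. Set t = -(v+1) and s = -u(v-2)(v² + v + 4)(v² + 6v + 4)/(v² + v - 1)². Then t² + t - 1 ≠ 0 and s³ = (t+3)³(t² + t + 4)³(t² - 4t - 1)³/(t² + t - 1)⁵. -/
/-- Lemma 6.5: compatibility of the forgetful maps from `X(ns 3⁺, s 5⁺)` (modelled by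
`v² + v = u³ + 1`) to `X(s 5⁺)` and `X(ns 3⁺)`: the cube of `s` equals the `j`-invariant
evaluated at `t`. -/
theorem forgetful_maps_ns3s5
    (u v : ℚ) (huv : v ^ 2 + v = u ^ 3 + 1) (hu : u ≠ 0)
    (t s : ℚ)
    (ht : t = -(v + 1))
    (hs : s = -u * (v - 2) * (v ^ 2 + v + 4) * (v ^ 2 + 6 * v + 4) / (v ^ 2 + v - 1) ^ 2) :
    t ^ 2 + t - 1 ≠ 0 ∧
    s ^ 3 = (t + 3) ^ 3 * (t ^ 2 + t + 4) ^ 3 * (t ^ 2 - 4 * t - 1) ^ 3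
      / (t ^ 2 + t - 1) ^ 5 := by
  have hD : v ^ 2 + v - 1 = u ^ 3 := by linear_combination huv
  have htD : t ^ 2 + t - 1 = u ^ 3 := by rw [ht]; linear_combination huv
  have h₁ : t + 3 = -(v - 2) := by rw [ht]; ring
  have h₂ : t ^ 2 + t + 4 = v ^ 2 + v + 4 := by rw [ht]; ring
  have h₃ : t ^ 2 - 4 * t - 1 = v ^ 2 + 6 * v + 4 := by rw [ht]; ring
  refine ⟨htD ▸ pow_ne_zero 3 hu, ?_⟩
  rw [hs, htD, hD, h₁, h₂, h₃]
  field_simp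
end

section
/- Let t ∈ ℚ with t² - 2t - 2 ≠ 0, t³ ≠ 4, and t³ ≠ -2. Define s = 3(t² - 2)(t² + 2)/(t² - 2t - 2)², u = 2(t-1)(t+2)/(t² - 2t - 2), and t₄ = (t² - 2t - 2)³/(24(t³ - 4)(t³ + 2)). Then: (i) 3s² = (u+1)²(u² - 2u + 3); and (ii) (32t₄ - 4)/t₄⁴ = 1728(1 - s²)³. -/
/-- Lemma 5.1: the rational parametrisation of the modular curve `X(ns 4, ns 3)/δ`
by the coordinate `t`. -/
theorem parametrisation_ns4ns3
    (t : ℚ) (h1 : t ^ 2 - 2 * t - 2 ≠ 0) (h2 : t ^ 3 ≠ 4) (h3 : t ^ 3 ≠ -2)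
    (s u t4 : ℚ)
    (hs : s = 3 * (t ^ 2 - 2) * (t ^ 2 + 2) / (t ^ 2 - 2 * t - 2) ^ 2)
    (hu : u = 2 * (t - 1) * (t + 2) / (t ^ 2 - 2 * t - 2))
    (ht4 : t4 = (t ^ 2 - 2 * t - 2) ^ 3 / (24 * (t ^ 3 - 4) * (t ^ 3 + 2))) :
    3 * s ^ 2 = (u + 1) ^ 2 * (u ^ 2 - 2 * u + 3) ∧
    (32 * t4 - 4) / t4 ^ 4 = 1728 * (1 - s ^ 2) ^ 3 := by
  have h2' : t ^ 3 - 4 ≠ 0 := sub_ne_zero.mpr h2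
  have h3' : t ^ 3 + 2 ≠ 0 := fun h => h3 (eq_neg_of_add_eq_zero_left h)
  subst hs hu ht4
  -- Opaque denominators keep `field_simp` from rewriting them before cancelling.
  generalize hd : t ^ 2 - 2 * t - 2 = d at *
  generalize ha : t ^ 3 - 4 = a at *
  generalize hb : t ^ 3 + 2 = b at *
  constructor
  · field_simp
    rw [← hd]
    ring
  · field_simp
    rw [← hd, ← ha, ← hb]
    ring
end

section
/- Let x, y ∈ ℚ with y² = x³ + x² - 4x - 4, x ≠ -4, and 2x + y + 2 ≠ 0. Define s = (6x³ + x²y + 14x² + 12xy - 8x + 8y - 16)/((x+4)²(2x + y + 2)) and u = 6(x² + 3x + y + 2)/((x+4)(2x + y + 2)). Then 4s²u(u³ - 4) = -3(s² - 1)(3s² + 1). -/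
/-- The homogenized equation of the model, with the denominators of `s` and `u` cleared. -/
theorem ns4s3_equation_cleared {R : Type*} [CommRing R] (x y : R)
    (hxy : y ^ 2 = x ^ 3 + x ^ 2 - 4 * x - 4) :
    4 * (6 * x ^ 3 + x ^ 2 * y + 14 * x ^ 2 + 12 * x * y - 8 * x + 8 * y - 16) ^ 2
        * (6 * (x ^ 2 + 3 * x + y + 2))
        * ((6 * (x ^ 2 + 3 * x + y + 2)) ^ 3 - 4 * ((x + 4) * (2 * x + y + 2)) ^ 3)
      = -3 * (2 * x + y + 2) ^ 2
        * ((6 * x ^ 3 + x ^ 2 * y + 14 * x ^ 2 + 12 * x * y - 8 * x + 8 * y - 16) ^ 2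
          - ((x + 4) ^ 2 * (2 * x + y + 2)) ^ 2)
        * (3 * (6 * x ^ 3 + x ^ 2 * y + 14 * x ^ 2 + 12 * x * y - 8 * x + 8 * y - 16) ^ 2
          + ((x + 4) ^ 2 * (2 * x + y + 2)) ^ 2) := by
  linear_combination
    ((-201984 * x ^ 11 - 2717952 * x ^ 10 - 15687168 * x ^ 9 - 50904576 * x ^ 8
        - 103055616 * x ^ 7 - 139689216 * x ^ 6 - 141327360 * x ^ 5 - 127392768 * x ^ 4
        - 108896256 * x ^ 3 - 72646656 * x ^ 2 - 29294592 * x - 5111808)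
      + (-80640 * x ^ 10 - 1990656 * x ^ 9 - 16117248 * x ^ 8 - 65614848 * x ^ 7
        - 157741824 * x ^ 6 - 246948864 * x ^ 5 - 275856384 * x ^ 4 - 237281280 * x ^ 3
        - 154730496 * x ^ 2 - 65273856 * x - 12582912) * y
      + (-12096 * x ^ 9 - 425664 * x ^ 8 - 5227200 * x ^ 7 - 27478080 * x ^ 6
        - 75642624 * x ^ 5 - 123240960 * x ^ 4 - 130867200 * x ^ 3 - 95698944 * x ^ 2
        - 45121536 * x - 10027008) * y ^ 2
      + (-768 * x ^ 8 - 35328 * x ^ 7 - 597504 * x ^ 6 - 4489728 * x ^ 5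
        - 14648064 * x ^ 4 - 23746560 * x ^ 3 - 21872640 * x ^ 2 - 11993088 * x
        - 3145728) * y ^ 3
      + (-576 * x ^ 6 - 17664 * x ^ 5 - 202944 * x ^ 4 - 978432 * x ^ 3
        - 1517568 * x ^ 2 - 1044480 * x - 319488) * y ^ 4) * hxy

/-- Lemma 5.2: the explicit isomorphism from the elliptic curve 48.a4
(`y² = x³ + x² - 4x - 4`) to the model `4s²u(u³ - 4) = -3(s² - 1)(3s² + 1)` of
`X(ns 4, s 3)/δ`. -/
theorem iso_48a4_to_ns4s3
    (x y : ℚ) (hxy : y ^ 2 = x ^ 3 + x ^ 2 - 4 * x - 4)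
    (hx : x ≠ -4) (hden : 2 * x + y + 2 ≠ 0)
    (s u : ℚ)
    (hs : s = (6 * x ^ 3 + x ^ 2 * y + 14 * x ^ 2 + 12 * x * y - 8 * x + 8 * y - 16)
      / ((x + 4) ^ 2 * (2 * x + y + 2)))
    (hu : u = 6 * (x ^ 2 + 3 * x + y + 2) / ((x + 4) * (2 * x + y + 2))) :
    4 * s ^ 2 * u * (u ^ 3 - 4) = -3 * (s ^ 2 - 1) * (3 * s ^ 2 + 1) := by
  have ha : x + 4 ≠ 0 := fun h => hx (eq_neg_of_add_eq_zero_left h)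
  have key := ns4s3_equation_cleared x y hxy
  generalize 6 * x ^ 3 + x ^ 2 * y + 14 * x ^ 2 + 12 * x * y - 8 * x + 8 * y - 16 = n at hs key
  generalize 6 * (x ^ 2 + 3 * x + y + 2) = m at hu key
  generalize 2 * x + y + 2 = d at *
  generalize x + 4 = a at *
  subst hs hu
  field_simp
  linear_combination key
end

section
/- Let x, y ∈ ℚ with y² = x³ - 39x - 70 and 3x - y + 15 ≠ 0. Define s = -2(3x + y + 15)/(3x - y + 15) and u = 12(x - 1)(x + 5)(x + 11)/(3x - y + 15)². Then u² = 3(s² - 2s + 4)(s² + 2s + 4). -/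
/-- Lemma 5.6(i): the explicit isomorphism from the elliptic curve 72.a4
(`y² = x³ - 39x - 70`) to the model `u² = 3(s² - 2s + 4)(s² + 2s + 4)` of
`X(G₁₁(√-1), ns 3)/δ`. -/
theorem iso_72a4_to_G11ns3
    (x y : ℚ) (hxy : y ^ 2 = x ^ 3 - 39 * x - 70) (hden : 3 * x - y + 15 ≠ 0)
    (s u : ℚ)
    (hs : s = -2 * (3 * x + y + 15) / (3 * x - y + 15))
    (hu : u = 12 * (x - 1) * (x + 5) * (x + 11) / (3 * x - y + 15) ^ 2) :
    u ^ 2 = 3 * (s ^ 2 - 2 * s + 4) * (s ^ 2 + 2 * s + 4) := by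
  have h₁ : 3 * (3 * x + 15) ^ 2 + y ^ 2 = (x + 5) * (x + 11) ^ 2 := by
    linear_combination hxy
  have h₂ : (3 * x + 15) ^ 2 + 3 * y ^ 2 = 3 * (x + 5) * (x - 1) ^ 2 := by
    linear_combination 3 * hxy
  subst hs hu
  generalize hd : 3 * x - y + 15 = d at hden ⊢
  field_simp
  subst hd
  linear_combination (-48) * ((3 * x + 15) ^ 2 + 3 * y ^ 2) * h₁ -
    48 * (x + 5) * (x + 11) ^ 2 * h₂
end

section
/- The polynomial X³ + X² - 3X + 3 is irreducible over ℚ. Moreover, letting θ denote the image of X in K = ℚ[X]/(X³ + X² - 3X + 3), the following factorisation holds in K[x]: 4x⁶ + 12x⁵ - 20x³ + 12x + 1 = (4x⁴ + 8x³ + (-2θ² - 2θ)x² + (-2θ² - 2θ - 4)x + θ² - 2θ + 1) · (x² + x + (θ² + θ - 4)/2). -/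
open Polynomial

theorem irreducible_cubic : Irreducible (X ^ 3 + X ^ 2 - 3 * X + 3 : ℚ[X]) := by
  have hd : (X ^ 3 + X ^ 2 - 3 * X + 3 : ℚ[X]).natDegree = 3 := by compute_degree!
  refine irreducible_of_degree_le_three_of_not_isRoot (by simp [hd]) fun x hx => ?_
  have hm : (X ^ 3 + X ^ 2 - 3 * X + 3 : ℤ[X]).Monic := by monicity!
  have hr : aeval x (X ^ 3 + X ^ 2 - 3 * X + 3 : ℤ[X]) = 0 := by
    simpa [IsRoot.def, map_ofNat] using hx
  obtain ⟨n, rfl⟩ := isInteger_of_is_root_of_monic hm hr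
  have hn : n ^ 3 + n ^ 2 - 3 * n + 3 = 0 := by
    have h : (n : ℚ) ^ 3 + (n : ℚ) ^ 2 - 3 * n + 3 = 0 := by simpa [map_ofNat] using hr
    exact_mod_cast h
  have no_root_mod_seven : ∀ a : ZMod 7, a ^ 3 + a ^ 2 - 3 * a + 3 ≠ 0 := by decide
  apply no_root_mod_seven n
  exact_mod_cast congrArg (Int.cast : ℤ → ZMod 7) hn

theorem two_mul_algebraMap_half (A : Type*) [Ring A] [Algebra ℚ A] :
    2 * algebraMap ℚ A (1 / 2) = 1 := by
  rw [← map_ofNat (algebraMap ℚ A) 2, ← map_mul]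
  norm_num

/-- The factorisation holds in any commutative ring containing a root `p` of the cubic and an
inverse `c` of `2`. -/
theorem sextic_eq_mul_of_cubic_eq_zero {R : Type*} [CommRing R] {p c : R} (x : R)
    (hp : p ^ 3 + p ^ 2 - 3 * p + 3 = 0) (hc : 2 * c = 1) :
    4 * x ^ 6 + 12 * x ^ 5 - 20 * x ^ 3 + 12 * x + 1
      = (4 * x ^ 4 + 8 * x ^ 3 + (-2 * p ^ 2 - 2 * p) * x ^ 2
            + (-2 * p ^ 2 - 2 * p - 4) * x + (p ^ 2 - 2 * p + 1))
         * (x ^ 2 + x + (p ^ 2 + p - 4) * c) := by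
  linear_combination
    (-((2 * x ^ 4 + 4 * x ^ 3 - (p ^ 2 + p) * x ^ 2 - (p ^ 2 + p + 2) * x) * (p ^ 2 + p - 4) + 1))
      * hc + ((p + 1) * (x ^ 2 + x) - c * (p - 2)) * hp

/-- The cubic `X³ + X² - 3X + 3` is irreducible over `ℚ`, and over
`K = ℚ[X]/(X³ + X² - 3X + 3)` with `θ` the image of `X`, the sextic
`4x⁶ + 12x⁵ - 20x³ + 12x + 1` factors as a quartic times a quadratic.
(The coefficient `(θ² + θ - 4)/2` is written as `(θ² + θ - 4) · (1/2)` using the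
`ℚ`-algebra structure of `K`.) -/
theorem sextic_factorisation_over_cubic_field :
    Irreducible (X ^ 3 + X ^ 2 - 3 * X + 3 : ℚ[X]) ∧
    (letI K := AdjoinRoot (X ^ 3 + X ^ 2 - 3 * X + 3 : ℚ[X])
     letI θ : K := AdjoinRoot.root _
     (4 * X ^ 6 + 12 * X ^ 5 - 20 * X ^ 3 + 12 * X + 1 : K[X])
       = (4 * X ^ 4 + 8 * X ^ 3 + C (-2 * θ ^ 2 - 2 * θ) * X ^ 2
            + C (-2 * θ ^ 2 - 2 * θ - 4) * X + C (θ ^ 2 - 2 * θ + 1))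
         * (X ^ 2 + X + C ((θ ^ 2 + θ - 4) * algebraMap ℚ K (1 / 2)))) := by
  refine ⟨irreducible_cubic, ?_⟩
  have hθ : (AdjoinRoot.root (X ^ 3 + X ^ 2 - 3 * X + 3 : ℚ[X])) ^ 3
      + (AdjoinRoot.root _) ^ 2 - 3 * AdjoinRoot.root _ + 3 = 0 := by
    have h := AdjoinRoot.eval₂_root (X ^ 3 + X ^ 2 - 3 * X + 3 : ℚ[X])
    simpa only [eval₂_add, eval₂_sub, eval₂_mul, eval₂_pow, eval₂_X, eval₂_ofNat] using h
  have hc : 2 * algebraMap ℚ (AdjoinRoot (X ^ 3 + X ^ 2 - 3 * X + 3 : ℚ[X])) (1 / 2) = 1 :=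
    two_mul_algebraMap_half _
  have hθ' := congrArg C hθ
  have hc' := congrArg C hc
  simp only [map_add, map_sub, map_mul, map_pow, map_neg, map_ofNat, map_one, map_zero]
    at hθ' hc' ⊢
  exact sextic_eq_mul_of_cubic_eq_zero X hθ' hc'
end

section
/- The rational solutions (x, y) ∈ ℚ² of y² = x³ + x² - 4x - 4 are exactly the three points (-2, 0), (-1, 0), and (2, 0). Equivalently, the group of rational points of the elliptic curve y² = x³ + x² - 4x - 4 (LMFDB label 48.a4) is isomorphic to ℤ/2ℤ × ℤ/2ℤ. -/
theorem Int.emod_and_sq_emod_eight (z : ℤ) :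
    (z % 2 = 1 ∧ z ^ 2 % 8 = 1) ∨ (z % 4 = 2 ∧ z ^ 2 % 8 = 4) ∨ (z % 4 = 0 ∧ z ^ 2 % 8 = 0) := by
  have h : z % 8 = 0 ∨ z % 8 = 1 ∨ z % 8 = 2 ∨ z % 8 = 3 ∨ z % 8 = 4 ∨ z % 8 = 5 ∨ z % 8 = 6 ∨
    z % 8 = 7 := by omega
  rcases h with h | h | h | h | h | h | h | h <;> simp [pow_two, Int.mul_emod, h] <;> omega

theorem Int.eq_of_dvd_three {k : ℤ} (h : k ∣ 3) : k = 1 ∨ k = -1 ∨ k = 3 ∨ k = -3 := by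
  rw [← Int.natAbs_dvd_natAbs] at h
  have := (Nat.dvd_prime Nat.prime_three).mp h
  omega

/-- If `b² - e²` and `b² - 4e²` are both squares of integers, then `e = 0`. -/
theorem Int.eq_zero_of_sq_sub_sq_of_sq_sub_four_mul_sq {a b c e : ℤ}
    (ha : b ^ 2 - e ^ 2 = a ^ 2) (hc : b ^ 2 - 4 * e ^ 2 = c ^ 2) : e = 0 := by
  induction hn : e.natAbs using Nat.strong_induction_on generalizing a b c e with
  | _ n ih =>
  subst hn
  by_contra he
  have descend : ∀ {a' b' c' e' : ℤ}, b' ^ 2 - e' ^ 2 = a' ^ 2 → b' ^ 2 - 4 * e' ^ 2 = c' ^ 2 →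
      e' ≠ 0 → ∀ f : ℤ, e = f * e' → 1 < f.natAbs → False := by
    intro a' b' c' e' h₁ h₂ h₃ f hf hf'
    refine h₃ (ih e'.natAbs ?_ h₁ h₂ rfl)
    rw [hf, Int.natAbs_mul]
    have := Int.natAbs_pos.mpr h₃
    nlinarith
  have hcop : IsCoprime b e := by
    rw [Int.isCoprime_iff_gcd_eq_one]
    by_contra hg
    have hg0 : Int.gcd b e ≠ 0 := fun h => he (Int.gcd_eq_zero_iff.mp h).2
    obtain ⟨g, hgdef⟩ : ∃ g : ℤ, g = (Int.gcd b e : ℤ) := ⟨_, rfl⟩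
    have hgz : g ≠ 0 := by omega
    obtain ⟨b', hb'⟩ : g ∣ b := hgdef ▸ Int.gcd_dvd_left ..
    obtain ⟨e', he'⟩ : g ∣ e := hgdef ▸ Int.gcd_dvd_right ..
    have hga : g ∣ a := (Int.pow_dvd_pow_iff two_ne_zero).mp
      ⟨b' ^ 2 - e' ^ 2, by rw [← ha, hb', he']; ring⟩
    have hgc : g ∣ c := (Int.pow_dvd_pow_iff two_ne_zero).mp
      ⟨b' ^ 2 - 4 * e' ^ 2, by rw [← hc, hb', he']; ring⟩
    obtain ⟨a', rfl⟩ := hga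
    obtain ⟨c', rfl⟩ := hgc
    refine descend (a' := a') (b' := b') (c' := c') (e' := e') ?_ ?_ ?_ g he' (by omega)
    · apply mul_left_cancel₀ (pow_ne_zero 2 hgz)
      rw [hb', he'] at ha; linear_combination ha
    · apply mul_left_cancel₀ (pow_ne_zero 2 hgz)
      rw [hb', he'] at hc; linear_combination hc
    · rintro rfl; simp at he'; exact he he'
  clear ih
  wlog hb : 0 < b generalizing b
  · have hb0 : b ≠ 0 := by
      rintro rfl
      have : 0 < e ^ 2 := by positivity
      nlinarith [sq_nonneg a]
    exact this (b := -b) (by linarith [neg_sq b]) (by linarith [neg_sq b]) hcop.neg_left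
      (by omega)
  have hae : Int.gcd a e = 1 := by
    rw [← Int.isCoprime_iff_gcd_eq_one, ← IsCoprime.pow_left_iff two_pos, ← ha]
    have := (hcop.pow_left (m := 2)).add_mul_right_left (-e)
    rwa [show b ^ 2 + -e * e = b ^ 2 - e ^ 2 by ring] at this
  have hodd : a % 2 = 1 ∧ e % 2 = 0 ∧ c % 2 = 1 := by
    have hbe : ¬ (b % 2 = 0 ∧ e % 2 = 0) := by
      rintro ⟨h₁, h₂⟩
      have := hcop.isUnit_of_dvd' (x := 2) (by omega) (by omega)
      norm_num [Int.isUnit_iff] at this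
    have := a.emod_and_sq_emod_eight; have := b.emod_and_sq_emod_eight
    have := c.emod_and_sq_emod_eight; have := e.emod_and_sq_emod_eight
    omega
  obtain ⟨hao, hee, hco⟩ := hodd
  have hce : Int.gcd c (2 * e) = 1 := by
    rw [← Int.isCoprime_iff_gcd_eq_one]
    refine IsCoprime.mul_right ?_ ?_
    · exact ⟨1, -(c / 2), by omega⟩
    · rw [← IsCoprime.pow_left_iff two_pos, ← hc]
      have := (hcop.pow_left (m := 2)).add_mul_right_left (-4 * e)
      rwa [show b ^ 2 + -4 * e * e = b ^ 2 - 4 * e ^ 2 by ring] at this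
  obtain ⟨u, v, -, heuv, hbuv, -, -, -⟩ :=
    PythagoreanTriple.coprime_classification' (x := a) (y := e) (z := b)
      (by unfold PythagoreanTriple; linear_combination -ha) hae hao hb
  obtain ⟨s, t, hst, hst2, hbst, hpar⟩ : ∃ s t : ℤ, s * t = u * v ∧ IsCoprime s t ∧
      b = s ^ 2 + 4 * t ^ 2 ∧ s % 2 = 1 := by
    obtain ⟨s, t, -, h₁, h₂, h₃, h₄, -⟩ :=
      PythagoreanTriple.coprime_classification' (x := c) (y := 2 * e) (z := b)
        (by unfold PythagoreanTriple; linear_combination -hc) hce hco hb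
    rw [← Int.isCoprime_iff_gcd_eq_one] at h₃
    rcases h₄ with ⟨h₄, h₅⟩ | ⟨h₄, h₅⟩
    · obtain ⟨s', rfl⟩ : 2 ∣ s := by omega
      exact ⟨t, s', by linarith, h₃.symm.of_mul_right_right, by rw [h₂]; ring, h₅⟩
    · obtain ⟨t', rfl⟩ : 2 ∣ t := by omega
      exact ⟨s, t', by linarith, h₃.of_mul_right_right, by rw [h₂]; ring, h₄⟩
  have hs0 : s ≠ 0 := by omega
  obtain ⟨p, q, ⟨r, rfl⟩, ⟨w, rfl⟩, rfl⟩ := exists_dvd_and_dvd_of_dvd_mul (Dvd.intro t hst)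
  obtain rfl : t = r * w := mul_left_cancel₀ hs0 (by linear_combination hst)
  have hp0 : p ≠ 0 := by rintro rfl; simp at heuv; exact he heuv
  have hq0 : q ≠ 0 := by rintro rfl; simp at heuv; exact he heuv
  have hr0 : r ≠ 0 := by rintro rfl; simp at heuv; exact he heuv
  have hw0 : w ≠ 0 := by rintro rfl; simp at heuv; exact he heuv
  have hpw : IsCoprime p w := hst2.of_mul_left_left.of_mul_right_right
  have hqr : IsCoprime q r := hst2.of_mul_left_right.of_mul_right_left
  have hp2 : p % 2 = 1 := Int.odd_iff.mp (Int.Odd.of_mul_left (Int.odd_iff.mpr hpar))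
  have hq2 : q % 2 = 1 := Int.odd_iff.mp (Int.Odd.of_mul_right (Int.odd_iff.mpr hpar))
  have key : p ^ 2 * (q ^ 2 - r ^ 2) = w ^ 2 * (q ^ 2 - 4 * r ^ 2) := by
    linear_combination hbuv - hbst
  obtain ⟨k, hk⟩ : w ^ 2 ∣ q ^ 2 - r ^ 2 :=
    hpw.symm.pow.dvd_of_dvd_mul_left (Dvd.intro _ key.symm)
  have hk' : q ^ 2 - 4 * r ^ 2 = p ^ 2 * k :=
    mul_left_cancel₀ (pow_ne_zero 2 hw0) (by rw [← key, hk]; ring)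
  have hk3 : k ∣ 3 := by
    obtain ⟨α, β, h⟩ := (hqr.pow (m := 2) (n := 2))
    exact ⟨α * (4 * w ^ 2 - p ^ 2) + β * (w ^ 2 - p ^ 2), by
      linear_combination -3 * h + (4 * α + β) * hk - (α + β) * hk'⟩
  have hf : ∀ f g h : ℤ, f ≠ 0 → g ≠ 0 → h ≠ 0 → 1 < (2 * f * g * h).natAbs := by
    intro f g h hf hg hh
    have : (f * g * h).natAbs ≠ 0 := by simp [hf, hg, hh]
    have h2 : 2 * f * g * h = 2 * (f * g * h) := by ring
    omega
  rcases Int.eq_of_dvd_three hk3 with rfl | rfl | rfl | rfl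
  · exact descend (a' := w) (b' := q) (c' := p) (e' := r) (by linarith) (by linarith) hr0
      (2 * p * q * w) (by rw [heuv]; ring) (hf p q w hp0 hq0 hw0)
  · have := p.emod_and_sq_emod_eight; have := q.emod_and_sq_emod_eight
    have := r.emod_and_sq_emod_eight; have := w.emod_and_sq_emod_eight; omega
  · have h : 4 * w ^ 2 - p ^ 2 = q ^ 2 := by linarith
    have := p.emod_and_sq_emod_eight; have := q.emod_and_sq_emod_eight
    have := r.emod_and_sq_emod_eight; have := w.emod_and_sq_emod_eight; omega
  · exact descend (a' := r) (b' := p) (c' := q) (e' := w) (by linarith) (by linarith) hw0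
      (2 * p * q * r) (by rw [heuv]; ring) (hf p q r hp0 hq0 hr0)

/-- If `e² - b²` and `4e² - b²` are both squares of integers, then `b = 0`. -/
theorem Int.eq_zero_of_sq_sub_sq_of_four_mul_sq_sub_sq {a b c e : ℤ}
    (ha : e ^ 2 - b ^ 2 = a ^ 2) (hc : 4 * e ^ 2 - b ^ 2 = c ^ 2) : b = 0 := by
  have hpar : b % 2 = 0 ∧ c % 2 = 0 := by
    have := b.emod_and_sq_emod_eight; have := c.emod_and_sq_emod_eight
    omega
  obtain ⟨b', rfl⟩ : 2 ∣ b := by omega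
  obtain ⟨c', rfl⟩ : 2 ∣ c := by omega
  simp [Int.eq_zero_of_sq_sub_sq_of_sq_sub_four_mul_sq (a := c') (b := e) (c := a) (e := b')
    (by linarith) (by linarith)]

/-- Every nonzero integer is a squarefree integer times a square. -/
theorem Int.exists_squarefree_mul_sq {n : ℤ} (hn : n ≠ 0) :
    ∃ d b : ℤ, Squarefree d ∧ b ≠ 0 ∧ n = d * b ^ 2 := by
  obtain ⟨d, b, h, hd⟩ := Nat.sq_mul_squarefree n.natAbs
  have hb : (b : ℤ) ≠ 0 := by
    rintro hb
    have hb : b = 0 := by exact_mod_cast hb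
    subst hb; simp at h; omega
  have h' : (n.natAbs : ℤ) = b ^ 2 * d := by exact_mod_cast h.symm
  rcases Int.natAbs_eq n with hs | hs
  · exact ⟨d, b, Int.squarefree_natCast.mpr hd, hb, by rw [hs, h']; ring⟩
  · exact ⟨-d, b, by rw [← Int.squarefree_natAbs]; simpa using hd, hb, by rw [hs, h']; ring⟩

theorem Squarefree.exists_eq_mul_sq_of_mul_sq_mul_eq_sq {d b n w : ℤ} (hd : Squarefree d)
    (hb : b ≠ 0) (h : d * b ^ 2 * n = w ^ 2) : ∃ c, n = d * c ^ 2 := by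
  obtain ⟨w, rfl⟩ : b ∣ w := (Int.pow_dvd_pow_iff two_ne_zero).mp ⟨d * n, by rw [← h]; ring⟩
  have h : d * n = w ^ 2 := mul_left_cancel₀ (pow_ne_zero 2 hb) (by linear_combination h)
  obtain ⟨c, rfl⟩ : d ∣ w := (hd.dvd_pow_iff_dvd two_ne_zero).mp (Dvd.intro _ h)
  exact ⟨c, mul_left_cancel₀ hd.ne_zero (by linear_combination h)⟩

/-- The integral form of `y² = X (X + 1) (X - 3)` with `X = m / e²` has no solution with
`y ≠ 0`. -/
theorem Int.eq_zero_of_sq_eq_mul_add_sq_mul_sub_three_mul_sq {m e w : ℤ} (he : e ≠ 0)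
    (hme : IsCoprime m e) (h : w ^ 2 = m * (m + e ^ 2) * (m - 3 * e ^ 2)) : w = 0 := by
  by_contra hw
  have hw2 : m * (m + e ^ 2) * (m - 3 * e ^ 2) ≠ 0 := h ▸ pow_ne_zero 2 hw
  have hA := left_ne_zero_of_mul (left_ne_zero_of_mul hw2)
  have hB := right_ne_zero_of_mul (left_ne_zero_of_mul hw2)
  have hC := right_ne_zero_of_mul hw2
  obtain ⟨d₁, a, hd₁, ha, hA'⟩ := Int.exists_squarefree_mul_sq hA
  obtain ⟨d₂, b, hd₂, hb, hB'⟩ := Int.exists_squarefree_mul_sq hB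
  have hAB : IsCoprime m (m + e ^ 2) := by
    simpa [add_comm] using (hme.pow_right (n := 2)).add_mul_left_right 1
  have hBe : IsCoprime (m + e ^ 2) (e ^ 2) := by
    simpa using (hme.pow_right (n := 2)).add_mul_left_left 1
  have hm1 : d₁ ∣ m := Dvd.intro _ hA'.symm
  have hm2 : d₂ ∣ m + e ^ 2 := Dvd.intro _ hB'.symm
  have h12 : IsCoprime d₁ d₂ := (hAB.of_isCoprime_of_dvd_left hm1).of_isCoprime_of_dvd_right hm2
  have h1 : d₁ ∣ 3 := by
    obtain ⟨c, hc⟩ := hd₁.exists_eq_mul_sq_of_mul_sq_mul_eq_sq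
      (n := (m + e ^ 2) * (m - 3 * e ^ 2)) (w := w) ha (by rw [← hA', h]; ring)
    have h1C : d₁ ∣ m - 3 * e ^ 2 :=
      (hAB.of_isCoprime_of_dvd_left hm1).dvd_of_dvd_mul_left (Dvd.intro _ hc.symm)
    have := (dvd_sub_right hm1).mp h1C
    exact ((hme.pow_right (n := 2)).of_isCoprime_of_dvd_left hm1).dvd_of_dvd_mul_right this
  have h2 : d₂ ∣ 4 := by
    obtain ⟨c, hc⟩ := hd₂.exists_eq_mul_sq_of_mul_sq_mul_eq_sq
      (n := m * (m - 3 * e ^ 2)) (w := w) hb (by rw [← hB', h]; ring)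
    have h2C : d₂ ∣ m - 3 * e ^ 2 :=
      (hAB.symm.of_isCoprime_of_dvd_left hm2).dvd_of_dvd_mul_left (Dvd.intro _ hc.symm)
    have : d₂ ∣ 4 * e ^ 2 := by
      have := dvd_sub hm2 h2C
      ring_nf at this ⊢; exact this
    exact (hBe.of_isCoprime_of_dvd_left hm2).dvd_of_dvd_mul_right this
  obtain ⟨c, hC'⟩ := Squarefree.exists_eq_mul_sq_of_mul_sq_mul_eq_sq (d := d₁ * d₂)
    (b := a * b) (n := m - 3 * e ^ 2) (w := w)
    ((squarefree_mul_iff).mpr ⟨h12.isRelPrime, hd₁, hd₂⟩) (mul_ne_zero ha hb)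
    (by rw [h, hB', hA']; ring)
  have hc : c ≠ 0 := by rintro rfl; simp [hC'] at hC
  have hae : ¬ (a % 2 = 0 ∧ e % 2 = 0) := by
    rintro ⟨h₁, h₂⟩
    have h₃ : (2 : ℤ) ∣ m := hA' ▸ Dvd.dvd.mul_left (dvd_pow (by omega) two_ne_zero) _
    have := hme.isUnit_of_dvd' h₃ (by omega)
    norm_num [Int.isUnit_iff] at this
  have hd2c : d₂ = 1 ∨ d₂ = 2 ∨ d₂ < 0 := by
    have h1' := Int.le_of_dvd (by norm_num) h2
    by_contra! hd
    have h4 : d₂ = 4 := by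
      obtain ⟨hx, hy, hz⟩ := hd
      interval_cases d₂ <;> omega
    subst h4
    have := hd₂ 2 (by norm_num)
    norm_num [Int.isUnit_iff] at this
  have ha2 : 0 < a ^ 2 := by positivity
  have hb2 : 0 < b ^ 2 := by positivity
  have hc2 : 0 < c ^ 2 := by positivity
  have he2 : 0 < e ^ 2 := by positivity
  rw [hA'] at hB' hC'
  rcases hd2c with rfl | rfl | hneg
  · rcases Int.eq_of_dvd_three h1 with rfl | rfl | rfl | rfl
    · exact he (Int.eq_zero_of_sq_sub_sq_of_sq_sub_four_mul_sq (a := a) (b := b) (c := c)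
        (by linarith) (by linarith))
    · exact hb (Int.eq_zero_of_sq_sub_sq_of_four_mul_sq_sub_sq (a := a) (e := e) (c := c)
        (by linarith) (by linarith))
    · exact hc (Int.eq_zero_of_sq_sub_sq_of_four_mul_sq_sub_sq (a := e) (e := a) (c := b)
        (by linarith) (by linarith))
    · exact ha (Int.eq_zero_of_sq_sub_sq_of_sq_sub_four_mul_sq (a := e) (b := c) (c := b)
        (by linarith) (by linarith))
  · have := a.emod_and_sq_emod_eight; have := b.emod_and_sq_emod_eight
    have := c.emod_and_sq_emod_eight; have := e.emod_and_sq_emod_eight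
    rcases Int.eq_of_dvd_three h1 with rfl | rfl | rfl | rfl <;> omega
  · rcases Int.eq_of_dvd_three h1 with rfl | rfl | rfl | rfl <;> nlinarith

theorem Rat.eq_zero_of_sq_eq_mul_add_one_mul_sub_three (x y : ℚ) (h : y ^ 2 = x * (x + 1) * (x - 3)) : y = 0 := by
  have hdq : (x.den : ℚ) ≠ 0 := by exact_mod_cast x.den_ne_zero
  have hcop : IsCoprime x.num (x.den : ℤ) := by
    rw [Int.isCoprime_iff_gcd_eq_one]; exact x.reduced
  obtain ⟨n, hn⟩ : ∃ n, n = x.num := ⟨_, rfl⟩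
  obtain ⟨d, hd⟩ : ∃ d : ℤ, d = x.den := ⟨_, rfl⟩
  have hdQ : (d : ℚ) ≠ 0 := by rw [hd]; exact_mod_cast hdq
  have hx : x = n / d := by rw [hn, hd]; exact_mod_cast (Rat.num_div_den x).symm
  rw [← hn, ← hd] at hcop
  have hdpos : 0 < d := by rw [hd]; exact_mod_cast x.den_pos
  have hsq : (y * d ^ 2) ^ 2 = ((d * (n * (n + d) * (n - 3 * d)) : ℤ) : ℚ) := by
    rw [mul_pow, h, hx]; push_cast; field_simp
  obtain ⟨w, hw⟩ : ∃ w : ℤ, d * (n * (n + d) * (n - 3 * d)) = w ^ 2 := by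
    obtain ⟨w, hw⟩ := Rat.isSquare_intCast_iff.mp ⟨y * d ^ 2, by rw [← hsq]; ring⟩
    exact ⟨w, by rw [hw]; ring⟩
  have hc2 : IsCoprime d (n * (n + d) * (n - 3 * d)) := by
    refine (hcop.symm.mul_right ?_).mul_right ?_
    · simpa using hcop.symm.add_mul_left_right 1
    · simpa [sub_eq_add_neg, mul_comm] using hcop.symm.add_mul_left_right (-3)
  obtain ⟨e, he | he⟩ := Int.sq_of_isCoprime hc2 hw
  swap
  · nlinarith [sq_nonneg e]
  have he0 : e ≠ 0 := by rintro rfl; simp [he] at hdpos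
  subst he
  obtain ⟨w, rfl⟩ : e ∣ w := (Int.pow_dvd_pow_iff two_ne_zero).mp (Dvd.intro _ hw)
  have hw' : w ^ 2 = n * (n + e ^ 2) * (n - 3 * e ^ 2) :=
    mul_left_cancel₀ (pow_ne_zero 2 he0) (by linear_combination -hw)
  have hw0 := Int.eq_zero_of_sq_eq_mul_add_sq_mul_sub_three_mul_sq he0
    ((IsCoprime.pow_right_iff two_pos).mp hcop) hw'
  rw [hw, hw0] at hsq
  simpa [he0] using hsq

/-- The rational points of the elliptic curve `y² = x³ + x² - 4x - 4`
(LMFDB label 48.a4) are exactly the three 2-torsion points `(-2,0)`, `(-1,0)`, `(2,0)`. -/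
theorem rational_points_48a4 (x y : ℚ) :
    y ^ 2 = x ^ 3 + x ^ 2 - 4 * x - 4 ↔
      (x, y) ∈ ({(-2, 0), (-1, 0), (2, 0)} : Set (ℚ × ℚ)) := by
  simp only [Set.mem_insert_iff, Set.mem_singleton_iff, Prod.mk.injEq]
  constructor
  · intro h
    have hy : y = 0 := Rat.eq_zero_of_sq_eq_mul_add_one_mul_sub_three (x + 1) y (by rw [h]; ring)
    subst hy
    have : (x + 2) * ((x + 1) * (x - 2)) = 0 := by linear_combination -h
    rcases mul_eq_zero.mp this with h | h
    · exact .inl ⟨by linarith, rfl⟩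
    rcases mul_eq_zero.mp h with h | h
    · exact .inr (.inl ⟨by linarith, rfl⟩)
    · exact .inr (.inr ⟨by linarith, rfl⟩)
  · rintro (⟨rfl, rfl⟩ | ⟨rfl, rfl⟩ | ⟨rfl, rfl⟩) <;> norm_num
end

section
/- The rational solutions (x, y) ∈ ℚ² of y² = x³ + x² - x are exactly the five points (0, 0), (1, 1), (1, -1), (-1, 1), and (-1, -1). Equivalently, the group of rational points of the elliptic curve y² = x³ + x² - x (LMFDB label 20.a3) is isomorphic to ℤ/6ℤ. -/
theorem Int.exists_eq_pow_four_of_mul_eq {A B c : ℤ} (hA : 0 < A) (hB : 0 < B) (hc : 0 < c)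
    (hAB : IsCoprime A B) (h : A * B = c ^ 4) :
    ∃ g k : ℤ, 0 < g ∧ 0 < k ∧ A = g ^ 4 ∧ B = k ^ 4 ∧ c = g * k := by
  have key : ∀ {A B : ℤ}, 0 < A → IsCoprime A B → A * B = c ^ 4 → ∃ g : ℤ, 0 < g ∧ A = g ^ 4 := by
    intro A B hA hAB h
    obtain ⟨d, hd⟩ := exists_associated_pow_of_mul_eq_pow' hAB h
    have h1 : A = |d| ^ 4 := by
      have h2 := Int.associated_iff_natAbs.1 hd
      have h3 : |d ^ 4| = |A| := by rw [Int.abs_eq_natAbs, Int.abs_eq_natAbs, h2]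
      rw [abs_pow, abs_of_pos hA] at h3
      exact h3.symm
    refine ⟨|d|, abs_pos.2 ?_, h1⟩
    rintro rfl
    norm_num at h1
    omega
  obtain ⟨g, hg, rfl⟩ := key hA hAB h
  obtain ⟨k, hk, rfl⟩ := key hB hAB.symm (by rw [mul_comm]; exact h)
  refine ⟨g, k, hg, hk, rfl, rfl, ?_⟩
  rw [← mul_pow] at h
  exact ((pow_left_inj₀ (by positivity) hc.le (by norm_num)).1 h).symm

theorem isCoprime_of_add_mul_of_mul {A B k s c : ℤ} {n : ℕ} (hs : A + k * B = s) (h : A * B = c ^ n)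
    (hsc : IsCoprime s c) : IsCoprime A B := by
  have h1 : IsCoprime (A + k * B) (A * B) := by
    rw [hs, h]
    exact hsc.pow_right
  exact IsCoprime.of_add_mul_right_left h1.of_mul_right_right

/-- Splitting `5 β⁴ = P Q` into coprime factors, up to exchanging `P` and `Q`. -/
theorem Int.exists_pow_four_add_five_mul {P Q β s : ℤ} (hβ : 0 < β) (hs : 0 < s) (hPQ : P + Q = s)
    (h : P * Q = 5 * β ^ 4) (hsβ : IsCoprime s β) :
    ∃ u v : ℤ, 0 < u ∧ 0 < v ∧ u ^ 4 + 5 * v ^ 4 = s ∧ β = u * v := by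
  wlog h5 : (5 : ℤ) ∣ Q generalizing P Q
  · refine this (P := Q) (Q := P) (by rw [add_comm]; exact hPQ) (by rw [mul_comm]; exact h) ?_
    have : Prime (5 : ℤ) := by norm_num
    exact (this.dvd_or_dvd (Dvd.intro _ h.symm)).resolve_right h5
  obtain ⟨R, rfl⟩ := h5
  have hmul : P * R = β ^ 4 := by linarith
  have hpos : 0 < P * R := by rw [hmul]; positivity
  have hP : 0 < P := by
    by_contra hn
    rcases pos_and_pos_or_neg_and_neg_of_mul_pos hpos with ⟨h1, _⟩ | ⟨h1, h2⟩ <;> omega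
  have hR : 0 < R := pos_of_mul_pos_right hpos hP.le
  obtain ⟨u, v, hu, hv, rfl, rfl, huv⟩ :=
    Int.exists_eq_pow_four_of_mul_eq hP hR hβ (isCoprime_of_add_mul_of_mul hPQ hmul hsβ) hmul
  exact ⟨u, v, hu, hv, hPQ, huv⟩

theorem Int.exists_eq_pow_four_of_add_eq_of_mul_eq {A B v s : ℤ} (hv : 0 < v) (hs : 0 < s)
    (hAB : A + B = s)
    (h : A * B = v ^ 4) (hsv : IsCoprime s v) :
    ∃ g k : ℤ, 0 < g ∧ 0 < k ∧ A = g ^ 4 ∧ B = k ^ 4 ∧ v = g * k := by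
  have hpos : 0 < A * B := by rw [h]; positivity
  have hA : 0 < A := by
    by_contra hn
    rcases pos_and_pos_or_neg_and_neg_of_mul_pos hpos with ⟨h1, _⟩ | ⟨h1, h2⟩ <;> omega
  exact Int.exists_eq_pow_four_of_mul_eq hA (pos_of_mul_pos_right hpos hA.le) hv
    (isCoprime_of_add_mul_of_mul (k := 1) (by rw [one_mul]; exact hAB) h hsv) h

theorem eq_one_of_sq_eq_pow_four_add_sq_sub_one {a c : ℤ} (ha : 0 < a)
    (h : c ^ 2 = a ^ 4 + a ^ 2 - 1) : a = 1 := by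
  have h1 : a ^ 2 ≤ |c| := abs_le_of_sq_le_sq' (a := a ^ 2) (b := |c|)
    (by rw [sq_abs, h]; nlinarith) (abs_nonneg c) |>.2
  have h2 : |c| < a ^ 2 + 1 := lt_of_pow_lt_pow_left₀ 2 (by positivity)
    (by rw [sq_abs, h]; nlinarith)
  have h3 : |c| = a ^ 2 := by omega
  rw [← sq_abs, h3] at h
  nlinarith

/-- One step of 2-isogeny descent on the quartic `c² = a⁴ + a²b² - b⁴`. -/
theorem exists_smaller_of_sq_eq {a b c : ℤ} (ha : 0 < a) (hb : 0 < b) (hab : IsCoprime a b)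
    (h : c ^ 2 = a ^ 4 + a ^ 2 * b ^ 2 - b ^ 4) :
    ∃ g k u : ℤ, 0 < g ∧ 0 < k ∧ 0 < u ∧ IsCoprime k g ∧
      u ^ 2 = k ^ 4 + k ^ 2 * g ^ 2 - g ^ 4 ∧
      (b = u * (g * k) ∨ b = 2 * (u * (g * k)) ∧ ¬ Even (u ^ 2 - (g * k) ^ 2)) := by
  have fin : ∀ {g k v u s : ℤ}, IsCoprime s v → v = g * k → g ^ 4 + k ^ 4 = s →
      u ^ 2 - v ^ 2 = k ^ 4 - g ^ 4 →
      IsCoprime k g ∧ u ^ 2 = k ^ 4 + k ^ 2 * g ^ 2 - g ^ 4 := by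
    intro g k v u s hsv hv hs hu
    subst hv
    refine ⟨?_, by linarith [mul_pow g k 2]⟩
    have h1 : IsCoprime (g ^ 4 + 1 * k ^ 4) k := by
      rw [one_mul, hs]
      exact hsv.of_mul_right_right
    have h2 : IsCoprime (g ^ 4) k := by
      rw [show g ^ 4 + 1 * k ^ 4 = g ^ 4 + k * k ^ 3 by ring] at h1
      exact h1.of_add_mul_left_left
    exact ((IsCoprime.pow_left_iff (by norm_num)).1 h2).symm
  rcases Int.even_or_odd b with hbe | hbo
  · obtain ⟨β, rfl⟩ := hbe
    have hβ : 0 < β := by omega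
    have hao : Odd a := by
      by_contra hn
      rw [Int.not_odd_iff_even] at hn
      obtain ⟨t, rfl⟩ := hn
      have : IsUnit (2 : ℤ) := hab.isUnit_of_dvd' ⟨t, by ring⟩ ⟨β, by ring⟩
      exact absurd (Int.isUnit_iff.1 this) (by norm_num)
    have hco : Odd c := by
      by_contra hn
      rw [Int.not_odd_iff_even] at hn
      obtain ⟨t, rfl⟩ := hn
      have : Even (a ^ 4) := ⟨2 * t ^ 2 - 2 * a ^ 2 * β ^ 2 + 8 * β ^ 4, by linarith⟩
      exact absurd this (Int.not_even_iff_odd.2 hao.pow)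
    have haβ : IsCoprime a β := by
      rw [← two_mul] at hab
      exact hab.of_mul_right_right
    obtain ⟨P, hP⟩ : Even (a ^ 2 + 2 * β ^ 2 - c) := by
      have := (hao.pow (n := 2)).sub_odd hco
      have h2 : Even (2 * β ^ 2) := even_two_mul _
      rw [add_sub_right_comm]
      exact this.add h2
    have hsβ : IsCoprime (a ^ 2 + 2 * β ^ 2) β := by
      rw [show a ^ 2 + 2 * β ^ 2 = a ^ 2 + β * (2 * β) by ring]
      exact (haβ.pow_left (m := 2)).add_mul_left_left _
    obtain ⟨u, v, hu, hv, huv, rfl⟩ := Int.exists_pow_four_add_five_mul (P := P) (Q := P + c) hβ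
      (by positivity) (by linarith) (by
        have hc : c = a ^ 2 + 2 * β ^ 2 - 2 * P := by linarith
        subst hc
        linarith) hsβ
    have hw : Odd (u ^ 2 - v ^ 2) := by
      by_contra hn
      rw [Int.not_odd_iff_even] at hn
      obtain ⟨t, ht⟩ := hn
      have : a ^ 2 = 2 * (2 * t ^ 2 + 2 * v ^ 4) := by
        have : u ^ 2 = v ^ 2 + t + t := by linarith
        have h4 : u ^ 4 = (v ^ 2 + t + t) ^ 2 := by rw [← this]; ring
        linarith [mul_pow u v 2, congrArg (· * v ^ 2) this]
      exact absurd (this ▸ even_two_mul _) (Int.not_even_iff_odd.2 (hao.pow (n := 2)))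
    obtain ⟨A, hA⟩ := hao.sub_odd hw
    have hav : IsCoprime a v := haβ.of_mul_right_right
    obtain ⟨g, k, hg, hk, h1, h2, hgk⟩ := Int.exists_eq_pow_four_of_add_eq_of_mul_eq (A := A)
      (B := A + (u ^ 2 - v ^ 2)) hv ha (by linarith) (by
        have : a = A + A + (u ^ 2 - v ^ 2) := by linarith
        subst this
        linarith) hav
    obtain ⟨hco, hq⟩ := fin (u := u) hav hgk (by linarith) (by linarith)
    refine ⟨g, k, u, hg, hk, hu, hco, hq, Or.inr ⟨by rw [← hgk]; ring, ?_⟩⟩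
    rw [← hgk]
    exact Int.not_even_iff_odd.2 hw
  · have h2b : IsCoprime (2 : ℤ) b := by
      obtain ⟨t, rfl⟩ := hbo
      exact ⟨-t, 1, by ring⟩
    have hsb : IsCoprime (2 * (2 * a ^ 2 + b ^ 2)) b := by
      refine h2b.mul_left ?_
      rw [show 2 * a ^ 2 + b ^ 2 = 2 * a ^ 2 + b * b by ring]
      exact (h2b.mul_left (hab.pow_left (m := 2))).add_mul_left_left _
    obtain ⟨u, v, hu, hv, huv, rfl⟩ := Int.exists_pow_four_add_five_mul
      (P := 2 * a ^ 2 + b ^ 2 - 2 * c) (Q := 2 * a ^ 2 + b ^ 2 + 2 * c) hb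
      (by positivity) (by ring) (by linarith) hsb
    obtain ⟨hu2, hv2⟩ := Int.odd_mul.1 hbo
    obtain ⟨X, hX⟩ := (hu2.pow (n := 2)).sub_odd (hv2.pow (n := 2))
    have hav : IsCoprime (2 * a) v :=
      h2b.of_mul_right_right.mul_left hab.of_mul_right_right
    obtain ⟨g, k, hg, hk, h1, h2, hgk⟩ := Int.exists_eq_pow_four_of_add_eq_of_mul_eq (A := a - X)
      (B := a + X) hv (s := 2 * a) (by positivity) (by ring) (by
        have h2 : u ^ 2 = v ^ 2 + X + X := by linarith
        have h4 : u ^ 4 = (v ^ 2 + X + X) ^ 2 := by rw [← h2]; ring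
        linarith [mul_pow u v 2, congrArg (· * v ^ 2) h2]) hav
    obtain ⟨hco, hq⟩ := fin (u := u) hav hgk (by linarith) (by linarith)
    exact ⟨g, k, u, hg, hk, hu, hco, hq, Or.inl (by rw [← hgk])⟩

theorem eq_one_of_sq_eq_pow_four_add_sub {a b c : ℤ} (ha : 0 < a) (hb : 0 < b)
    (hab : IsCoprime a b) (h : c ^ 2 = a ^ 4 + a ^ 2 * b ^ 2 - b ^ 4) : a = 1 ∧ b = 1 := by
  suffices hb1 : b = 1 by
    subst hb1
    exact ⟨eq_one_of_sq_eq_pow_four_add_sq_sub_one ha (by linarith), rfl⟩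
  induction hn : b.toNat using Nat.strong_induction_on generalizing a b c with
  | _ n ih =>
    obtain ⟨g, k, u, hg, hk, hu, hco, hq, hbg⟩ := exists_smaller_of_sq_eq ha hb hab h
    have hgk : g ≤ u * (g * k) := by nlinarith [mul_pos hg hk, mul_pos hu (mul_pos hg hk)]
    have hg1 : g = 1 := by
      by_cases hlt : g < b
      · exact ih g.toNat (by omega) hk hg hco hq rfl
      · have hge : b = g := by omega
        have hb' : b = u * (g * k) := by omega
        have h1 : u * k = 1 := by
          apply mul_left_cancel₀ hg.ne'
          linarith
        have hk1 : k = 1 := Int.eq_one_of_mul_eq_one_left hk.le h1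
        have hu1 : u = 1 := Int.eq_one_of_mul_eq_one_right hu.le h1
        subst hk1 hu1
        have : g ^ 2 * (g ^ 2 - 1) = 0 := by linarith
        nlinarith [(mul_eq_zero.1 this).resolve_left (by positivity)]
    subst hg1
    have hk1 := eq_one_of_sq_eq_pow_four_add_sq_sub_one (c := u) hk (by linarith)
    subst hk1
    have hu1 : u = 1 := by nlinarith
    subst hu1
    rcases hbg with hbg | ⟨_, hbg⟩
    · linarith
    · norm_num at hbg

/-- An integer solution of `z² = m n (m² + mn - n²)` with `m`, `n` coprime and `n > 0`. -/
theorem eq_of_sq_eq_mul_mul {m n z : ℤ} (hn : 0 < n) (hmn : IsCoprime m n)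
    (h : z ^ 2 = m * (n * (m ^ 2 + m * n - n ^ 2))) (hm : m ≠ 0) : n = 1 ∧ (m = 1 ∨ m = -1) := by
  have hq1 : IsCoprime m (m ^ 2 + m * n - n ^ 2) := by
    rw [show m ^ 2 + m * n - n ^ 2 = -n ^ 2 + m * (m + n) by ring]
    exact (hmn.pow_right (n := 2)).neg_right.add_mul_left_right _
  have hq2 : IsCoprime n (m ^ 2 + m * n - n ^ 2) := by
    rw [show m ^ 2 + m * n - n ^ 2 = m ^ 2 + n * (m - n) by ring]
    exact (hmn.symm.pow_right (n := 2)).add_mul_left_right _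
  obtain ⟨b, hb⟩ := Int.sq_of_isCoprime (hmn.symm.mul_right hq2)
    (show n * (m * (m ^ 2 + m * n - n ^ 2)) = z ^ 2 by rw [h]; ring)
  obtain ⟨a, ha⟩ := Int.sq_of_isCoprime (hmn.mul_right hq1) h.symm
  obtain ⟨c, hc⟩ := Int.sq_of_isCoprime (hq1.symm.mul_right hq2.symm)
    (show (m ^ 2 + m * n - n ^ 2) * (m * n) = z ^ 2 by rw [h]; ring)
  have hb : n = |b| ^ 2 := by
    rw [sq_abs]
    rcases hb with hb | hb
    · exact hb
    · nlinarith
  have hb0 : 0 < |b| := by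
    refine abs_pos.2 ?_
    rintro rfl
    norm_num at hb
    omega
  have ha : m = |a| ^ 2 ∨ m = -|a| ^ 2 := by rwa [sq_abs]
  have ha0 : 0 < |a| := by
    refine abs_pos.2 ?_
    rintro rfl
    norm_num at ha
    omega
  generalize |a| = a at *
  generalize |b| = b at *
  subst hb
  have hz : m * (m ^ 2 + m * b ^ 2 - (b ^ 2) ^ 2) ≥ 0 := by
    have : 0 ≤ b ^ 2 * (m * (m ^ 2 + m * b ^ 2 - (b ^ 2) ^ 2)) := by nlinarith [sq_nonneg z]
    exact nonneg_of_mul_nonneg_right this hn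
  have hab : IsCoprime a b := by
    have : IsCoprime (a ^ 2) (b ^ 2) := by
      rcases ha with rfl | rfl
      · exact hmn
      · exact (IsCoprime.neg_left_iff _ _).1 hmn
    exact (IsCoprime.pow_iff (by norm_num) (by norm_num)).1 this
  rcases ha with rfl | rfl
  · have h1 : c ^ 2 = a ^ 4 + a ^ 2 * b ^ 2 - b ^ 4 := by
      have := nonneg_of_mul_nonneg_right hz (by positivity)
      rcases hc with hc | hc
      · linarith
      · nlinarith [sq_nonneg c]
    obtain ⟨rfl, rfl⟩ := eq_one_of_sq_eq_pow_four_add_sub ha0 hb0 hab h1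
    norm_num
  · have h1 : c ^ 2 = b ^ 4 + b ^ 2 * a ^ 2 - a ^ 4 := by
      have : 0 ≤ a ^ 2 * -((-a ^ 2) ^ 2 + -a ^ 2 * b ^ 2 - (b ^ 2) ^ 2) := by linarith
      have := nonneg_of_mul_nonneg_right this (by positivity)
      rcases hc with hc | hc
      · nlinarith [sq_nonneg c]
      · linarith
    obtain ⟨rfl, rfl⟩ := eq_one_of_sq_eq_pow_four_add_sub hb0 ha0 hab.symm h1
    norm_num

/-- The rational points of the elliptic curve `y² = x³ + x² - x`
(LMFDB label 20.a3) are exactly the five points `(0,0)`, `(1,±1)`, `(-1,±1)`. -/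
theorem rational_points_20a3 (x y : ℚ) :
    y ^ 2 = x ^ 3 + x ^ 2 - x ↔
      (x, y) ∈ ({(0, 0), (1, 1), (1, -1), (-1, 1), (-1, -1)} : Set (ℚ × ℚ)) := by
  simp only [Set.mem_insert_iff, Set.mem_singleton_iff, Prod.mk.injEq]
  constructor
  · intro h
    by_cases hx : x = 0
    · subst hx
      left
      simpa using h
    have hxe : x * x.den = x.num := Rat.mul_den_eq_num x
    have hsq : (y * x.den ^ 2) ^ 2 =
        ((x.num * (x.den * (x.num ^ 2 + x.num * x.den - x.den ^ 2)) : ℤ) : ℚ) := by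
      push_cast
      rw [← hxe]
      linear_combination (x.den : ℚ) ^ 4 * h
    obtain ⟨z, hz⟩ : ∃ z : ℤ, (z : ℚ) = y * x.den ^ 2 := by
      have hint : IsIntegral ℤ (y * x.den ^ 2) := by
        refine IsIntegral.of_pow (n := 2) (by norm_num) ?_
        rw [hsq]
        exact isIntegral_algebraMap
      exact IsIntegrallyClosed.isIntegral_iff.1 hint
    rw [← hz] at hsq
    obtain ⟨h1, h2⟩ := eq_of_sq_eq_mul_mul (n := x.den) (by exact_mod_cast x.den_pos)
      (Int.isCoprime_iff_nat_coprime.2 (by simpa using x.reduced)) (by exact_mod_cast hsq)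
      (Rat.num_ne_zero.2 hx)
    have h1' : (x.den : ℚ) = 1 := by exact_mod_cast h1
    rw [h1', mul_one] at hxe
    have hx1 : x = 1 ∨ x = -1 := by
      rw [hxe]
      exact_mod_cast h2
    have hy : y = 1 ∨ y = -1 := by
      rw [← sq_eq_sq_iff_eq_or_eq_neg, h]
      rcases hx1 with hx1 | hx1 <;> norm_num [hx1]
    tauto
  · rintro (⟨rfl, rfl⟩ | ⟨rfl, rfl⟩ | ⟨rfl, rfl⟩ | ⟨rfl, rfl⟩ | ⟨rfl, rfl⟩) <;> norm_num
end
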